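/- Let G = PSL(2,ℤ) with r, u, S = {r, u, u⁻¹} as above, and let a ∈ {u, u⁻¹} with ā = a⁻¹. If g ∈ G satisfies 𝐒₂*(g) = {ra, ār}, then S⁺(g) = {a} and 𝐒₂*(g·a) = {ra, aa}. -/

import Mathlib

namespace PSL2Z

abbrev SL2Z : Type := Matrix.SpecialLinearGroup (Fin 2) ℤ

/-- `PSL(2,ℤ)`: the quotient of `SL(2,ℤ)` by its center `{±I}`. -/
abbrev G : Type := SL2Z ⧸ Subgroup.center SL2Z

/-- The image in `PSL(2,ℤ)` of the matrix `[[0,1],[-1,0]]`. -/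
def r : G := QuotientGroup.mk (⟨!![0, 1; -1, 0], by norm_num [Matrix.det_fin_two_of]⟩ : SL2Z)

/-- The image in `PSL(2,ℤ)` of the matrix `[[1,1],[0,1]]`. -/
def u : G := QuotientGroup.mk (⟨!![1, 1; 0, 1], by norm_num [Matrix.det_fin_two_of]⟩ : SL2Z)

/-- The symmetric generating set `S = {r, u, u⁻¹}`. -/
def S : Set G := {r, u, u⁻¹}

/-- A word in `S`: a finite list of elements of `S`. -/
def IsWord (w : List G) : Prop := ∀ x ∈ w, x ∈ S

/-- The word norm `|g|`: the least length of a word in `S` representing `g`. -/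
noncomputable def wordNorm (g : G) : ℕ :=
  sInf {n | ∃ w : List G, IsWord w ∧ w.prod = g ∧ w.length = n}

/-- A geodesic for `g`: a word in `S` representing `g` of length `|g|`. -/
def IsGeodesic (g : G) (w : List G) : Prop :=
  IsWord w ∧ w.prod = g ∧ w.length = wordNorm g

/-- `𝐒ₙ(g)`: the set of suffixes of length `n` of geodesics for `g`. -/
def Suf (n : ℕ) (g : G) : Set (List G) :=
  {v | v.length = n ∧ ∃ w : List G, IsGeodesic g w ∧ v <:+ w}

open Classical in
/-- `𝐒₂*(g)`: `𝐒₂(g)` if nonempty, otherwise `𝐒₁(g)` (which is `∅` exactly when `g = 1`). -/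
noncomputable def Suf2Star (g : G) : Set (List G) :=
  if (Suf 2 g).Nonempty then Suf 2 g else Suf 1 g

/-- `S⁺(g) = {s ∈ S : |g·s| = |g| + 1}`. -/
def Splus (g : G) : Set G := {s ∈ S | wordNorm (g * s) = wordNorm g + 1}


theorem entry_mul_entry_eq_of_mk_eq {M N : SL2Z}
    (h : (QuotientGroup.mk M : G) = QuotientGroup.mk N) (i j k l : Fin 2) :
    M i j * M k l = N i j * N k l := by
  rw [QuotientGroup.eq, Matrix.SpecialLinearGroup.mem_center_iff] at h
  obtain ⟨c, hc, hs⟩ := h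
  have hN : (N : Matrix (Fin 2) (Fin 2) ℤ) = c • (M : Matrix (Fin 2) (Fin 2) ℤ) := by
    have h1 : N = M * (M⁻¹ * N) := by group
    rw [h1, Matrix.SpecialLinearGroup.coe_mul, ← hs, Matrix.scalar_apply,
      ← Matrix.smul_one_eq_diagonal, Matrix.mul_smul, Matrix.mul_one]
  have hc' : c * c = 1 := by simpa [sq] using hc
  have e : ∀ i j, N i j = c * M i j := fun i j => by
    have := congrFun (congrFun hN i) j
    simpa using this
  rw [e, e]
  linear_combination (-(M i j * M k l)) * hc'

/-- The off-diagonal entry of `M * Mᵀ`. Its sign tells on which side of the edge `{1, r}` of the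
Cayley graph an element lies. -/
def side : G → ℤ :=
  Quotient.lift (fun M : SL2Z => M 0 0 * M 1 0 + M 0 1 * M 1 1) (by
    intro M N h
    have h' : (QuotientGroup.mk M : G) = QuotientGroup.mk N := Quotient.sound h
    simp only [entry_mul_entry_eq_of_mk_eq h'])

theorem side_mk (M : SL2Z) :
    side (QuotientGroup.mk M) = M 0 0 * M 1 0 + M 0 1 * M 1 1 := rfl

/-- The matrix `[[0,1],[-1,0]]` representing `r`. -/
def rMatrix : SL2Z := ⟨!![0, 1; -1, 0], by norm_num [Matrix.det_fin_two_of]⟩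

theorem coe_rMatrix : (rMatrix : Matrix (Fin 2) (Fin 2) ℤ) = !![0, 1; -1, 0] := rfl

theorem r_eq : r = QuotientGroup.mk rMatrix := rfl

theorem u_eq : u = QuotientGroup.mk ModularGroup.T := rfl

theorem u_inv_eq : u⁻¹ = QuotientGroup.mk ModularGroup.T⁻¹ := rfl

theorem mk_eq_one {M : SL2Z} (h : M 0 0 = M 1 1) (h₁ : M 0 1 = 0) (h₂ : M 1 0 = 0) :
    (QuotientGroup.mk M : G) = 1 := by
  have hd := M.det_coe
  rw [Matrix.det_fin_two, h₁, ← h] at hd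
  rw [QuotientGroup.eq_one_iff, Matrix.SpecialLinearGroup.mem_center_iff]
  refine ⟨M 0 0, by rw [Fintype.card_fin]; linarith, ?_⟩
  ext i j
  rw [Matrix.scalar_apply, Matrix.diagonal_apply]
  fin_cases i <;> fin_cases j <;> simp [h, h₁, h₂]

theorem r_mul_r : r * r = 1 := by
  rw [r_eq, ← QuotientGroup.mk_mul]
  apply mk_eq_one <;> simp [coe_rMatrix]

theorem r_inv : r⁻¹ = r := inv_eq_of_mul_eq_one_right r_mul_r

theorem eq_one_or_eq_r_of_side_eq_zero {g : G} (h : side g = 0) : g = 1 ∨ g = r := by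
  induction g using QuotientGroup.induction_on with
  | H M =>
  rw [side_mk] at h
  have hd := M.det_coe
  rw [Matrix.det_fin_two] at hd
  have key : ∀ a b c d : ℤ, a * c + b * d = 0 → a * d - b * c = 1 →
      (a = d ∧ b = 0 ∧ c = 0) ∨ (a = 0 ∧ d = 0 ∧ b = -c) := by
    intro a b c d h1 h2
    have hac : a * c = 0 := by
      have hbd : b * d = -(a * c) := by linarith
      have : (a * c) * (b * d) = (b * c) * (b * c + 1) := by
        linear_combination (b * c) * h2
      have hm : 0 ≤ (b * c) * (b * c + 1) := by
        rcases le_or_gt 0 (b * c) with h | h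
        · positivity
        · nlinarith
      have : (a * c) ^ 2 ≤ 0 := by rw [hbd] at this; nlinarith
      exact sq_eq_zero_iff.mp (le_antisymm this (sq_nonneg _))
    rcases mul_eq_zero.mp hac with rfl | rfl
    · right
      have h3 : b * (-c) = 1 := by linarith
      rcases Int.mul_eq_one_iff_eq_one_or_neg_one.mp h3 with ⟨h4, h5⟩ | ⟨h4, h5⟩ <;> subst h4 <;>
        refine ⟨rfl, by linarith, by linarith⟩
    · left
      have h3 : a * d = 1 := by linarith
      rcases Int.mul_eq_one_iff_eq_one_or_neg_one.mp h3 with ⟨h4, h5⟩ | ⟨h4, h5⟩ <;> subst h4 h5 <;>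
        refine ⟨rfl, by linarith, rfl⟩
  rcases key _ _ _ _ h hd with ⟨h1, h2, h3⟩ | ⟨h1, h2, h3⟩
  · exact Or.inl (mk_eq_one h1 h2 h3)
  · right
    rw [← mul_left_inj r, r_mul_r, r_eq, ← QuotientGroup.mk_mul]
    apply mk_eq_one <;> simp [coe_rMatrix, Matrix.mul_apply, Fin.sum_univ_two, h1, h2, h3]

theorem side_mul_r (g : G) : side (g * r) = side g := by
  induction g using QuotientGroup.induction_on with
  | H M =>
  rw [r_eq, ← QuotientGroup.mk_mul, side_mk, side_mk]
  simp [coe_rMatrix, Matrix.mul_apply, Fin.sum_univ_two]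
  ring

theorem nonneg_of_mul_eq_mul_succ {X Y m : ℤ} (h : X * Y = m * (m + 1)) (hpos : 0 < X + Y) :
    0 ≤ 2 * X + Y + (2 * m + 1) ∧ 0 ≤ 2 * X + Y - (2 * m + 1) := by
  have hm : 0 ≤ m * (m + 1) := by
    rcases le_or_gt 0 m with h | h
    · positivity
    · nlinarith
  have hX : 0 ≤ X := by
    by_contra! hX
    nlinarith
  have hsq : (2 * m + 1) ^ 2 - 1 ≤ (X + Y) ^ 2 := by nlinarith [sq_nonneg (X - Y)]
  constructor
  · by_contra! hlt
    have h1 : X + Y + 1 ≤ -(2 * m + 1) := by linarith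
    nlinarith
  · by_contra! hlt
    have h1 : X + Y + 1 ≤ 2 * m + 1 := by linarith
    nlinarith

theorem side_mul_side_mul_nonneg (g : G) {s : G} (hs : s ∈ S) : 0 ≤ side g * side (g * s) := by
  rcases hs with rfl | hs
  · rw [side_mul_r]
    exact mul_self_nonneg _
  induction g using QuotientGroup.induction_on with
  | H M =>
  have hd := M.det_coe
  rw [Matrix.det_fin_two] at hd
  have hXY : (M 0 0 * M 1 0) * (M 0 1 * M 1 1) = (M 0 1 * M 1 0) * (M 0 1 * M 1 0 + 1) := by
    linear_combination (M 0 1 * M 1 0) * hd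
  have hu : side (QuotientGroup.mk M * s) = 2 * (M 0 0 * M 1 0) + M 0 1 * M 1 1 +
        (2 * (M 0 1 * M 1 0) + 1) ∨
      side (QuotientGroup.mk M * s) = 2 * (M 0 0 * M 1 0) + M 0 1 * M 1 1 -
        (2 * (M 0 1 * M 1 0) + 1) := by
    rcases hs with rfl | rfl
    · left
      rw [u_eq, ← QuotientGroup.mk_mul, side_mk]
      simp [ModularGroup.coe_T, Matrix.mul_apply, Fin.sum_univ_two]
      linear_combination hd
    · right
      rw [u_inv_eq, ← QuotientGroup.mk_mul, side_mk]
      simp [ModularGroup.coe_T, Matrix.mul_apply, Fin.sum_univ_two]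
      linear_combination -hd
  rw [side_mk]
  rcases lt_trichotomy 0 (M 0 0 * M 1 0 + M 0 1 * M 1 1) with h | h | h
  · have := nonneg_of_mul_eq_mul_succ hXY h
    apply mul_nonneg h.le
    rcases hu with hu | hu <;> rw [hu]
    exacts [this.1, this.2]
  · simp [← h]
  · have := nonneg_of_mul_eq_mul_succ (X := -(M 0 0 * M 1 0)) (Y := -(M 0 1 * M 1 1))
      (by rw [neg_mul_neg, hXY]) (by linarith)
    apply mul_nonneg_of_nonpos_of_nonpos h.le
    rcases hu with hu | hu <;> rw [hu] <;> linarith [this.1, this.2]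

theorem exists_prefix_of_side_mul_side_nonpos (w : List G) (hw : IsWord w) (h : G)
    (hside : side h * side (h * w.prod) ≤ 0) :
    ∃ w₁ w₂, w = w₁ ++ w₂ ∧ (h * w₁.prod = 1 ∨ h * w₁.prod = r) := by
  induction w generalizing h with
  | nil =>
    refine ⟨[], [], rfl, ?_⟩
    apply eq_one_or_eq_r_of_side_eq_zero
    simp only [List.prod_nil, mul_one] at hside ⊢
    exact mul_self_eq_zero.mp (le_antisymm hside (mul_self_nonneg _))
  | cons s w ih =>
    by_cases h0 : side h = 0
    · exact ⟨[], s :: w, rfl, by simpa using eq_one_or_eq_r_of_side_eq_zero h0⟩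
    · have hstep := side_mul_side_mul_nonneg h (hw s (by simp))
      rw [List.prod_cons, ← mul_assoc] at hside
      have : side (h * s) * side (h * s * w.prod) ≤ 0 := by
        by_contra! hc
        nlinarith [mul_self_pos.mpr h0, mul_nonneg hstep hc.le, mul_pos (mul_self_pos.mpr h0) hc,
          mul_nonneg hstep (neg_nonneg.mpr hside), mul_self_nonneg (side (h * s))]
      obtain ⟨w₁, w₂, rfl, h1⟩ := ih (fun x hx => hw x (by simp [hx])) (h * s) this
      exact ⟨s :: w₁, w₂, rfl, by simpa [mul_assoc] using h1⟩

theorem wordNorm_le {w : List G} (hw : IsWord w) : wordNorm w.prod ≤ w.length :=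
  Nat.sInf_le ⟨w, hw, rfl, rfl⟩

theorem exists_isGeodesic_prod {w : List G} (hw : IsWord w) : ∃ v, IsGeodesic w.prod v :=
  Nat.sInf_mem (s := {n | ∃ v : List G, IsWord v ∧ v.prod = w.prod ∧ v.length = n})
    ⟨w.length, w, hw, rfl, rfl⟩

theorem IsWord.append {v w : List G} (hv : IsWord v) (hw : IsWord w) : IsWord (v ++ w) := by
  intro x hx
  rcases List.mem_append.mp hx with h | h
  exacts [hv x h, hw x h]

theorem IsWord.of_append_left {v w : List G} (h : IsWord (v ++ w)) : IsWord v :=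
  fun x hx => h x (List.mem_append_left w hx)

theorem IsWord.of_append_right {v w : List G} (h : IsWord (v ++ w)) : IsWord w :=
  fun x hx => h x (List.mem_append_right v hx)

theorem isWord_singleton {s : G} (hs : s ∈ S) : IsWord [s] := by
  intro x hx
  rwa [List.mem_singleton.mp hx]

theorem one_le_length_of_prod_ne_one {w : List G} (h : w.prod ≠ 1) : 1 ≤ w.length := by
  rcases w with _ | ⟨s, w⟩
  · exact absurd List.prod_nil h
  · simp

theorem two_le_length_of_prod_notMem {w : List G} (hw : IsWord w) (h : w.prod ≠ 1)
    (hS : w.prod ∉ S) : 2 ≤ w.length := by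
  rcases w with _ | ⟨s, _ | ⟨t, w⟩⟩
  · exact absurd List.prod_nil h
  · exact absurd (hw s (by simp)) (by simpa using hS)
  · simp

/-- A word for `g * k`, where `g⁻¹` and `k` lie on different sides of the edge `{1, r}`, passes
through `g` or `g * r`. -/
theorem exists_prefix_eq_or_eq_mul_r {w : List G} (hw : IsWord w) {g k : G} (hprod : w.prod = g * k)
    (hside : side g⁻¹ * side k ≤ 0) :
    ∃ w₁ w₂, w = w₁ ++ w₂ ∧
      ((w₁.prod = g ∧ w₂.prod = k) ∨ (w₁.prod = g * r ∧ w₂.prod = r * k)) := by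
  obtain ⟨w₁, w₂, rfl, h⟩ := exists_prefix_of_side_mul_side_nonpos w hw g⁻¹
    (by rwa [hprod, inv_mul_cancel_left])
  rw [List.prod_append] at hprod
  refine ⟨w₁, w₂, rfl, ?_⟩
  rcases h with h | h
  · have h1 : w₁.prod = g := (inv_mul_eq_one.mp h).symm
    exact Or.inl ⟨h1, by rwa [h1, mul_right_inj] at hprod⟩
  · have h1 : w₁.prod = g * r := inv_mul_eq_iff_eq_mul.mp h
    refine Or.inr ⟨h1, ?_⟩
    rw [h1, mul_assoc, mul_right_inj] at hprod
    rw [← hprod, ← mul_assoc, r_mul_r, one_mul]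

/-- If `g⁻¹` and `k` lie on different sides of the edge `{1, r}`, then `g * k` is farther from the
identity than `g`, unless `k` or `r * k` is too short. -/
theorem wordNorm_lt_length {g k : G} {w : List G} (hw : IsWord w) (hprod : w.prod = g * k)
    (hside : side g⁻¹ * side k ≤ 0) (hgr : wordNorm g ≤ wordNorm (g * r) + 1)
    (hk : k ≠ 1) (hrk : r * k ≠ 1) (hrkS : r * k ∉ S) : wordNorm g < w.length := by
  obtain ⟨w₁, w₂, rfl, h⟩ := exists_prefix_eq_or_eq_mul_r hw hprod hside
  have h1 := wordNorm_le hw.of_append_left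
  rw [List.length_append]
  rcases h with ⟨h, rfl⟩ | ⟨h, h'⟩ <;> rw [h] at h1
  · have := one_le_length_of_prod_ne_one hk
    omega
  · rw [← h'] at hrk hrkS
    have := two_le_length_of_prod_notMem hw.of_append_right hrk hrkS
    omega


theorem side_one : side 1 = 0 := by
  rw [← QuotientGroup.mk_one, side_mk]
  simp

theorem side_r : side r = 0 := by
  rw [← one_mul r, side_mul_r, side_one]

theorem ne_one_of_side_ne_zero {g : G} (h : side g ≠ 0) : g ≠ 1 := by
  rintro rfl
  exact h side_one

theorem side_r_mul (g : G) : side (r * g) = -side g := by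
  induction g using QuotientGroup.induction_on with
  | H M =>
  rw [r_eq, ← QuotientGroup.mk_mul, side_mk, side_mk]
  simp [coe_rMatrix, Matrix.mul_apply, Fin.sum_univ_two]
  ring

theorem r_mul_mk_notMem_S {M : SL2Z} (hM : M 1 0 * M 1 1 = 0)
    (hside : side (QuotientGroup.mk M) ≠ 0) : r * QuotientGroup.mk M ∉ S := by
  rintro (h | h | h)
  · have := side_r_mul (QuotientGroup.mk M)
    rw [h, side_r] at this
    omega
  all_goals
    rw [r_eq, u_eq, ← QuotientGroup.mk_mul] at h
    have := entry_mul_entry_eq_of_mk_eq h 0 0 0 1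
    simp [coe_rMatrix, ModularGroup.coe_T, Matrix.mul_apply, Fin.sum_univ_two, hM] at this


theorem side_ne_zero_of_unipotent {a : G} (ha : a ∈ ({u, u⁻¹} : Set G)) : side a ≠ 0 := by
  rcases ha with rfl | rfl
  · rw [u_eq, side_mk]
    simp [ModularGroup.coe_T]
  · rw [u_inv_eq, side_mk]
    simp [ModularGroup.coe_T]

theorem side_mul_self_of_unipotent {a : G} (ha : a ∈ ({u, u⁻¹} : Set G)) :
    side (a * a) = 2 * side a := by
  rcases ha with rfl | rfl
  · rw [u_eq, ← QuotientGroup.mk_mul, side_mk, side_mk]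
    simp [ModularGroup.coe_T, Matrix.mul_apply, Fin.sum_univ_two]
  · rw [u_inv_eq, ← QuotientGroup.mk_mul, side_mk, side_mk]
    simp [ModularGroup.coe_T, Matrix.mul_apply, Fin.sum_univ_two]

theorem r_mul_notMem_S_of_unipotent {a : G} (ha : a ∈ ({u, u⁻¹} : Set G)) :
    r * a ∉ S ∧ r * (a * a) ∉ S ∧ r * (a * r) ∉ S := by
  have h0 := side_ne_zero_of_unipotent ha
  have h1 : side (a * a) ≠ 0 := by
    rw [side_mul_self_of_unipotent ha]
    omega
  have h2 : side (a * r) ≠ 0 := by rwa [side_mul_r]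
  obtain ⟨M, rfl, hM0, hM1⟩ : ∃ M : SL2Z, QuotientGroup.mk M = a ∧ M 1 0 = 0 ∧ M 1 1 = 1 := by
    rcases ha with rfl | rfl
    · exact ⟨ModularGroup.T, rfl, by simp [ModularGroup.coe_T], by simp [ModularGroup.coe_T]⟩
    · exact ⟨ModularGroup.T⁻¹, rfl, by simp [ModularGroup.coe_T], by simp [ModularGroup.coe_T]⟩
  rw [r_eq] at h2 ⊢
  rw [← QuotientGroup.mk_mul] at h1 h2
  refine ⟨r_mul_mk_notMem_S ?_ h0, r_mul_mk_notMem_S ?_ h1, r_mul_mk_notMem_S ?_ h2⟩ <;>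
    simp [coe_rMatrix, Matrix.mul_apply, Fin.sum_univ_two, hM0, hM1]

theorem mem_S_of_unipotent {a : G} (ha : a ∈ ({u, u⁻¹} : Set G)) : a ∈ S := Or.inr ha

theorem inv_mem_S {s : G} (hs : s ∈ S) : s⁻¹ ∈ S := by
  rcases hs with rfl | rfl | rfl
  · rw [r_inv]
    exact Or.inl rfl
  · exact Or.inr (Or.inr rfl)
  · rw [inv_inv]
    exact Or.inr (Or.inl rfl)

theorem mem_S_iff_of_unipotent {a : G} (ha : a ∈ ({u, u⁻¹} : Set G)) {s : G} :
    s ∈ S ↔ s = r ∨ s = a ∨ s = a⁻¹ := by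
  rcases ha with rfl | rfl
  · rfl
  · rw [inv_inv, or_comm (a := s = u⁻¹)]
    rfl

theorem wordNorm_le_mul_add_one {w : List G} (hw : IsWord w) {s : G} (hs : s ∈ S) :
    wordNorm w.prod ≤ wordNorm (w.prod * s) + 1 := by
  have hws := hw.append (isWord_singleton hs)
  obtain ⟨v, hv, hvprod, hvlen⟩ := exists_isGeodesic_prod hws
  rw [List.prod_append, List.prod_singleton] at hvprod hvlen
  have := wordNorm_le (hv.append (isWord_singleton (inv_mem_S hs)))
  rw [List.prod_append, List.prod_singleton, hvprod, mul_inv_cancel_right, List.length_append,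
    hvlen] at this
  exact this

theorem IsGeodesic.isWord {g : G} {w : List G} (h : IsGeodesic g w) : IsWord w := h.1

theorem IsGeodesic.prod_eq {g : G} {w : List G} (h : IsGeodesic g w) : w.prod = g := h.2.1

theorem IsGeodesic.length_eq {g : G} {w : List G} (h : IsGeodesic g w) :
    w.length = wordNorm g := h.2.2

theorem Suf_eq_of_Suf2Star_eq {g : G} {A : Set (List G)} (h : Suf2Star g = A)
    {v : List G} (hv : v ∈ A) (hlen : v.length = 2) : Suf 2 g = A := by
  unfold Suf2Star at h
  split_ifs at h
  · exact h
  · rw [← h] at hv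
    exact absurd (hv.1.symm.trans hlen) (by norm_num)

/-- If `𝐒₂*(g) = {ra, ār}` (for `a = u` or `u⁻¹`) then `S⁺(g) = {a}` and
`𝐒₂*(g·a) = {ra, aa}`. -/
theorem type_ra_abar_r (a : G) (ha : a ∈ ({u, u⁻¹} : Set G))
    (g : G) (hg : Suf2Star g = ({[r, a], [a⁻¹, r]} : Set (List G))) :
    Splus g = {a} ∧ Suf2Star (g * a) = {[r, a], [a, a]} := by
  have hsuf := Suf_eq_of_Suf2Star_eq hg (Or.inl rfl) rfl
  have haS := mem_S_of_unipotent ha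
  have hrS : r ∈ S := Or.inl rfl
  have hmem_ra : [r, a] ∈ Suf 2 g := hsuf ▸ Or.inl rfl
  have hmem_ar : [a⁻¹, r] ∈ Suf 2 g := hsuf ▸ Or.inr rfl
  obtain ⟨-, w₁, hw₁, p₁, rfl⟩ := hmem_ra
  obtain ⟨-, w₂, hw₂, p₂, rfl⟩ := hmem_ar
  have hga_inv : wordNorm (g * a⁻¹) < wordNorm g := by
    have := wordNorm_le (w := p₁ ++ [r]) (by
      apply IsWord.of_append_left (w := [a])
      simpa using hw₁.isWord)
    have hp : (p₁ ++ [r]).prod = g * a⁻¹ := by simp [← hw₁.prod_eq, mul_assoc]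
    have hl := hw₁.length_eq
    simp only [List.length_append, List.length_cons, List.length_nil] at hl this
    rw [hp] at this
    omega
  have hgr_lt : wordNorm (g * r) < wordNorm g := by
    have := wordNorm_le (w := p₂ ++ [a⁻¹]) (by
      apply IsWord.of_append_left (w := [r])
      simpa using hw₂.isWord)
    have hp : (p₂ ++ [a⁻¹]).prod = g * r := by simp [← hw₂.prod_eq, mul_assoc, r_mul_r]
    have hl := hw₂.length_eq
    simp only [List.length_append, List.length_cons, List.length_nil] at hl this
    rw [hp] at this
    omega
  have hgr : wordNorm g ≤ wordNorm (g * r) + 1 := by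
    have := wordNorm_le_mul_add_one hw₁.isWord hrS
    rwa [hw₁.prod_eq] at this
  have hp₂ : p₂.prod = g * (r * a) := by simp [← hw₂.prod_eq, mul_assoc, ← mul_assoc r r, r_mul_r]
  have hside : side g⁻¹ * side a < 0 := by
    by_contra! hc
    obtain ⟨v₁, v₂, rfl, h⟩ := exists_prefix_eq_or_eq_mul_r hw₂.isWord.of_append_left hp₂
      (by rw [side_r_mul]; linarith)
    have hv := wordNorm_le hw₂.isWord.of_append_left.of_append_left
    have hl := hw₂.length_eq
    simp only [List.length_append, List.length_cons, List.length_nil] at hl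
    rcases h with ⟨h, -⟩ | ⟨h, -⟩ <;> rw [h] at hv <;> omega
  have ha0 := side_ne_zero_of_unipotent ha
  have haa := side_mul_self_of_unipotent ha
  obtain ⟨hraS, hraaS, hrarS⟩ := r_mul_notMem_S_of_unipotent ha
  have hlt_a : ∀ w, IsWord w → w.prod = g * a → wordNorm g < w.length := fun w hw hp =>
    wordNorm_lt_length hw hp hside.le hgr (ne_one_of_side_ne_zero ha0)
      (ne_one_of_side_ne_zero (by rw [side_r_mul]; omega)) hraS
  have hlt_aa : ∀ w, IsWord w → w.prod = g * (a * a) → wordNorm g < w.length := fun w hw hp =>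
    wordNorm_lt_length hw hp (by rw [haa]; linarith) hgr (ne_one_of_side_ne_zero (by omega))
      (ne_one_of_side_ne_zero (by rw [side_r_mul]; omega)) hraaS
  have hlt_ar : ∀ w, IsWord w → w.prod = g * (a * r) → wordNorm g < w.length := fun w hw hp =>
    wordNorm_lt_length hw hp (by rw [side_mul_r]; exact hside.le) hgr
      (ne_one_of_side_ne_zero (by rwa [side_mul_r]))
      (ne_one_of_side_ne_zero (by rw [side_r_mul, side_mul_r]; omega)) hrarS
  have hprod_a : ∀ {w}, IsGeodesic g w → IsWord (w ++ [a]) ∧ (w ++ [a]).prod = g * a ∧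
      (w ++ [a]).length = wordNorm g + 1 := fun hw =>
    ⟨hw.isWord.append (isWord_singleton haS), by simp [hw.prod_eq], by simp [hw.length_eq]⟩
  have hnorm : wordNorm (g * a) = wordNorm g + 1 := by
    obtain ⟨hw, hp, hl⟩ := hprod_a hw₁
    obtain ⟨v, hv, hvp, hvl⟩ := exists_isGeodesic_prod hw
    have h1 := wordNorm_le hw
    rw [hp] at h1 hvp hvl
    have h2 := hlt_a v hv hvp
    omega
  have hgeo : ∀ {w}, IsGeodesic g w → IsGeodesic (g * a) (w ++ [a]) := fun hw =>
    ⟨(hprod_a hw).1, (hprod_a hw).2.1, by rw [hnorm, (hprod_a hw).2.2]⟩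
  constructor
  · ext s
    simp only [Splus, Set.mem_ofPred_eq, Set.mem_singleton_iff]
    constructor
    · rintro ⟨hs, h⟩
      rcases (mem_S_iff_of_unipotent ha).mp hs with rfl | rfl | rfl
      · omega
      · rfl
      · omega
    · rintro rfl
      exact ⟨haS, hnorm⟩
  · have hmem : [r, a] ∈ Suf 2 (g * a) := ⟨rfl, _, hgeo hw₂, p₂ ++ [a⁻¹], by simp⟩
    rw [Suf2Star, if_pos ⟨_, hmem⟩]
    apply Set.Subset.antisymm
    · rintro v ⟨hv, w, hw, q, rfl⟩
      obtain ⟨s, t, rfl⟩ := List.length_eq_two.mp hv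
      have hqs : IsWord (q ++ [s]) := by
        apply IsWord.of_append_left (w := [t])
        simpa using hw.isWord
      have hql : (q ++ [s]).length = wordNorm g := by
        have := hw.length_eq
        simp only [List.length_append, List.length_cons, List.length_nil] at this ⊢
        omega
      have hqp : (q ++ [s]).prod = g * (a * t⁻¹) := by
        rw [← mul_assoc, ← hw.prod_eq]
        simp [mul_assoc]
      rcases (mem_S_iff_of_unipotent ha).mp (hw.isWord t (by simp)) with rfl | rfl | rfl
      · rw [r_inv] at hqp
        exact absurd (hlt_ar _ hqs hqp) (by omega)
      · rw [mul_inv_cancel, mul_one] at hqp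
        have hl₂ := hw₂.length_eq
        simp only [List.length_append, List.length_cons, List.length_nil] at hl₂ hql
        obtain ⟨q', x, rfl⟩ : ∃ q' x, q = q' ++ [x] := by
          rcases q.eq_nil_or_concat' with rfl | h
          · simp at hql
            omega
          · exact h
        have hxs : [x, s] ∈ Suf 2 g :=
          ⟨rfl, _, ⟨hqs, hqp, by simp at hql ⊢; omega⟩, q', by simp⟩
        rw [hsuf] at hxs
        rcases hxs with h | h
        · right
          simp_all
        · left
          simp_all
      · rw [inv_inv] at hqp
        exact absurd (hlt_aa _ hqs hqp) (by omega)
    · rintro v (rfl | rfl)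
      · exact hmem
      · exact ⟨rfl, _, hgeo hw₁, p₁ ++ [r], by simp⟩

end PSL2Z
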